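/- arXiv:1901.05895 — 2 statements merged into one kernel-verified Lean document; each statement's English description precedes it below -/
import Mathlib

section
/- Let N be a bipartite quantum channel taking matrices on ℂ^{d_{A'}} ⊗ ℂ^{d_{B'}} to matrices on ℂ^{d_A} ⊗ ℂ^{d_B}, and let J^N be its Choi matrix, viewed as a matrix on R_A ⊗ A ⊗ B ⊗ R_B where R_A is a copy of the A' input and R_B a copy of the B' input. Define Γ(N) = inf{ ‖Tr_{AB}(V + Y)‖_∞ : V, Y positive semidefinite on R_A ⊗ A ⊗ B ⊗ R_B and T_{B R_B}(V − Y) − J^N positive semidefinite }. For a positive semidefinite matrix τ on a bipartite space with cut X:Y, define W(X;Y)_τ = inf{ Tr(C + D) : C, D positive semidefinite and T_Y(C − D) − τ positive semidefinite }. Then for all finite ancilla dimensions d_{L_A}, d_{L_B} and every density matrix ρ on L_A ⊗ A' ⊗ B' ⊗ L_B: W(L_A A ; B L_B)_{N(ρ)} ≤ W(L_A A' ; B' L_B)_ρ · Γ(N), where N(ρ) = (id_{L_A} ⊗ N ⊗ id_{L_B})(ρ) and the partial transposes in the two W-quantities are taken over B' ⊗ L_B and B ⊗ L_B respectively. Equivalently,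 with R_max = log₂ W and the bidirectional max-Rains information R^{2→2}_max(N) = log₂ Γ(N): R_max(L_A A ; B L_B)_{N(ρ)} ≤ R_max(L_A A' ; B' L_B)_ρ + R^{2→2}_max(N), i.e., amortization does not enhance the bidirectional max-Rains information. -/
open Matrix
open scoped ComplexOrder

noncomputable section

/-- A density matrix: positive semidefinite with unit trace. -/
def DensityMatrix {n : Type*} [Fintype n] (ρ : Matrix n n ℂ) : Prop :=
  ρ.PosSemidef ∧ ρ.trace = 1

/-- The extension `id_r ⊗ N` of a linear map `N` on matrices. -/
def idTensor {m n r : Type*} (N : Matrix m m ℂ →ₗ[ℂ] Matrix n n ℂ)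
    (ρ : Matrix (r × m) (r × m) ℂ) : Matrix (r × n) (r × n) ℂ :=
  Matrix.of fun p q => N (Matrix.of fun u v => ρ (p.1, u) (q.1, v)) p.2 q.2

/-- A quantum channel: a trace-preserving and completely positive linear map on matrices. -/
def IsQuantumChannel {m n : Type*} [Fintype m] [Fintype n]
    (N : Matrix m m ℂ →ₗ[ℂ] Matrix n n ℂ) : Prop :=
  (∀ X, (N X).trace = X.trace) ∧
  ∀ (k : ℕ) (ρ : Matrix (Fin k × m) (Fin k × m) ℂ), ρ.PosSemidef → (idTensor N ρ).PosSemidef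

/-- The extension `id_{L_A} ⊗ N ⊗ id_{L_B}` of a bipartite linear map `N` on matrices,
where the total space is grouped as `(L_A × A') × (B' × L_B)`. -/
def extendChannel {mA mB nA nB LA LB : Type*}
    (N : Matrix (mA × mB) (mA × mB) ℂ →ₗ[ℂ] Matrix (nA × nB) (nA × nB) ℂ)
    (ρ : Matrix ((LA × mA) × (mB × LB)) ((LA × mA) × (mB × LB)) ℂ) :
    Matrix ((LA × nA) × (nB × LB)) ((LA × nA) × (nB × LB)) ℂ :=
  Matrix.of fun p q =>
    N (Matrix.of fun xy x'y' =>
        ρ ((p.1.1, xy.1), (xy.2, p.2.2)) ((q.1.1, x'y'.1), (x'y'.2, q.2.2)))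
      (p.1.2, p.2.1) (q.1.2, q.2.1)

/-- Partial transpose over the second tensor factor. -/
def ptB {X Y : Type*} (M : Matrix (X × Y) (X × Y) ℂ) : Matrix (X × Y) (X × Y) ℂ :=
  Matrix.of fun p q => M (p.1, q.2) (q.1, p.2)

/-- The operator norm (largest singular value) of a matrix. -/
def opNorm {m n : Type*} [Fintype m] [Fintype n] [DecidableEq n] (X : Matrix m n ℂ) : ℝ :=
  ⨆ i, Real.sqrt ((Matrix.posSemidef_conjTranspose_mul_self X).1.eigenvalues i)

/-- The quantity `W(X;Y)_τ = inf { Tr(C + D) : C, D ⪰ 0, T_Y(C − D) − τ ⪰ 0 }`, so that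
`R_max(X;Y)_τ = log₂ W(X;Y)_τ` is the max-Rains relative entropy. -/
def Wq {X Y : Type*} [Fintype X] [Fintype Y] (τ : Matrix (X × Y) (X × Y) ℂ) : ℝ :=
  sInf {r : ℝ | ∃ C D : Matrix (X × Y) (X × Y) ℂ, C.PosSemidef ∧ D.PosSemidef ∧
    (ptB (C - D) - τ).PosSemidef ∧ r = ((C + D).trace).re}

/-- The Choi matrix of a bipartite linear map `N`, on `R_A ⊗ A ⊗ B ⊗ R_B`
(indexed as `(R_A × A) × (B × R_B)` with `R_A ≅ A'`, `R_B ≅ B'`). -/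
def choi {dA' dB' dA dB : ℕ}
    (N : Matrix (Fin dA' × Fin dB') (Fin dA' × Fin dB') ℂ →ₗ[ℂ]
      Matrix (Fin dA × Fin dB) (Fin dA × Fin dB) ℂ) :
    Matrix ((Fin dA' × Fin dA) × (Fin dB × Fin dB'))
      ((Fin dA' × Fin dA) × (Fin dB × Fin dB')) ℂ :=
  Matrix.of fun p q =>
    N (Matrix.single (p.1.1, p.2.2) (q.1.1, q.2.2) 1) (p.1.2, p.2.1) (q.1.2, q.2.1)

/-- Partial trace over `A ⊗ B` of a matrix on `R_A ⊗ A ⊗ B ⊗ R_B`, leaving `R_A ⊗ R_B`. -/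
def ptrAB {dA' dB' dA dB : ℕ}
    (M : Matrix ((Fin dA' × Fin dA) × (Fin dB × Fin dB'))
      ((Fin dA' × Fin dA) × (Fin dB × Fin dB')) ℂ) :
    Matrix (Fin dA' × Fin dB') (Fin dA' × Fin dB') ℂ :=
  Matrix.of fun i j => ∑ u : Fin dA, ∑ v : Fin dB,
    M ((i.1, u), (v, i.2)) ((j.1, u), (v, j.2))

/-- `Γ(N) = inf { ‖Tr_{AB}(V + Y)‖_∞ : V, Y ⪰ 0, T_{B R_B}(V − Y) − J^N ⪰ 0 }`, so that
`R^{2→2}_max(N) = log₂ Γ(N)` is the bidirectional max-Rains information. -/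
def GammaN {dA' dB' dA dB : ℕ}
    (N : Matrix (Fin dA' × Fin dB') (Fin dA' × Fin dB') ℂ →ₗ[ℂ]
      Matrix (Fin dA × Fin dB) (Fin dA × Fin dB) ℂ) : ℝ :=
  sInf {r : ℝ | ∃ V Y : Matrix ((Fin dA' × Fin dA) × (Fin dB × Fin dB'))
      ((Fin dA' × Fin dA) × (Fin dB × Fin dB')) ℂ,
    V.PosSemidef ∧ Y.PosSemidef ∧ (ptB (V - Y) - choi N).PosSemidef ∧
    r = opNorm (ptrAB (V + Y))}

namespace MaxRains

section StarProduct

variable {LA LB mA mB nA nB : Type*} [Fintype mA] [Fintype mB]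

/-- The link product of `X` on `L_A ⊗ A' ⊗ B' ⊗ L_B` with `M` on `R_A ⊗ A ⊗ B ⊗ R_B`: the action of
the map with Choi matrix `M` on the `A' ⊗ B'` part of `X`. -/
def link (X : Matrix ((LA × mA) × (mB × LB)) ((LA × mA) × (mB × LB)) ℂ)
    (M : Matrix ((mA × nA) × (nB × mB)) ((mA × nA) × (nB × mB)) ℂ) :
    Matrix ((LA × nA) × (nB × LB)) ((LA × nA) × (nB × LB)) ℂ :=
  Matrix.of fun p q => ∑ i : mA × mB, ∑ j : mA × mB,
    X ((p.1.1, i.1), (i.2, p.2.2)) ((q.1.1, j.1), (j.2, q.2.2)) *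
      M ((i.1, p.1.2), (p.2.1, i.2)) ((j.1, q.1.2), (q.2.1, j.2))

lemma link_add_left (X X' : Matrix ((LA × mA) × (mB × LB)) ((LA × mA) × (mB × LB)) ℂ)
    (M : Matrix ((mA × nA) × (nB × mB)) ((mA × nA) × (nB × mB)) ℂ) :
    link (X + X') M = link X M + link X' M := by
  ext p q
  simp [link, add_mul, Finset.sum_add_distrib]

lemma link_sub_left (X X' : Matrix ((LA × mA) × (mB × LB)) ((LA × mA) × (mB × LB)) ℂ)
    (M : Matrix ((mA × nA) × (nB × mB)) ((mA × nA) × (nB × mB)) ℂ) :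
    link (X - X') M = link X M - link X' M := by
  ext p q
  simp [link, sub_mul, Finset.sum_sub_distrib]

lemma link_add_right (X : Matrix ((LA × mA) × (mB × LB)) ((LA × mA) × (mB × LB)) ℂ)
    (M M' : Matrix ((mA × nA) × (nB × mB)) ((mA × nA) × (nB × mB)) ℂ) :
    link X (M + M') = link X M + link X M' := by
  ext p q
  simp [link, mul_add, Finset.sum_add_distrib]

lemma link_sub_right (X : Matrix ((LA × mA) × (mB × LB)) ((LA × mA) × (mB × LB)) ℂ)
    (M M' : Matrix ((mA × nA) × (nB × mB)) ((mA × nA) × (nB × mB)) ℂ) :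
    link X (M - M') = link X M - link X M' := by
  ext p q
  simp [link, mul_sub, Finset.sum_sub_distrib]

/-- The link product commutes with the partial transpose. -/
lemma link_ptB (X : Matrix ((LA × mA) × (mB × LB)) ((LA × mA) × (mB × LB)) ℂ)
    (M : Matrix ((mA × nA) × (nB × mB)) ((mA × nA) × (nB × mB)) ℂ) :
    link (ptB X) (ptB M) = ptB (link X M) := by
  ext p q
  simp only [link, ptB, Matrix.of_apply]
  rw [← Fintype.sum_prod_type', ← Fintype.sum_prod_type']
  exact Fintype.sum_equiv
    ⟨fun x => ((x.1.1, x.2.2), (x.2.1, x.1.2)), fun x => ((x.1.1, x.2.2), (x.2.1, x.1.2)),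
      fun _ => rfl, fun _ => rfl⟩ _ _ fun _ => rfl

lemma posSemidef_sum_blocks {P I : Type*} [Fintype P] [Fintype I]
    {S : Matrix (P × I) (P × I) ℂ} (hS : S.PosSemidef) :
    (Matrix.of fun p q => ∑ i, ∑ j, S (p, i) (q, j)).PosSemidef := by
  classical
  convert hS.conjTranspose_mul_mul_same (Matrix.of fun (x : P × I) q => if x.1 = q then 1 else 0)
    using 1
  ext p q
  simp only [Matrix.of_apply, Matrix.mul_apply, Matrix.conjTranspose_apply,
    Fintype.sum_prod_type_right,
    apply_ite star, star_one, star_zero, ite_mul, one_mul, zero_mul, mul_ite, mul_one, mul_zero,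
    Finset.sum_ite_eq', Finset.mem_univ, if_true]
  exact Finset.sum_comm

lemma link_posSemidef [Fintype LA] [Fintype LB] [Fintype nA] [Fintype nB]
    {X : Matrix ((LA × mA) × (mB × LB)) ((LA × mA) × (mB × LB)) ℂ}
    {M : Matrix ((mA × nA) × (nB × mB)) ((mA × nA) × (nB × mB)) ℂ}
    (hX : X.PosSemidef) (hM : M.PosSemidef) : (link X M).PosSemidef := by
  have h := (hX.kronecker hM).submatrix fun x : ((LA × nA) × (nB × LB)) × (mA × mB) =>
    (((x.1.1.1, x.2.1), (x.2.2, x.1.2.2)), ((x.2.1, x.1.1.2), (x.1.2.1, x.2.2)))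
  convert posSemidef_sum_blocks h using 1
  ext p q
  simp only [link, Matrix.of_apply, Matrix.submatrix_apply, Matrix.kroneckerMap_apply]

end StarProduct

lemma extendChannel_eq_link {dA' dB' dA dB : ℕ} {LA LB : Type*}
    (N : Matrix (Fin dA' × Fin dB') (Fin dA' × Fin dB') ℂ →ₗ[ℂ]
      Matrix (Fin dA × Fin dB) (Fin dA × Fin dB) ℂ)
    (ρ : Matrix ((LA × Fin dA') × (Fin dB' × LB)) ((LA × Fin dA') × (Fin dB' × LB)) ℂ) :
    extendChannel N ρ = link ρ (choi N) := by
  ext p q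
  simp only [extendChannel, link, choi, Matrix.of_apply]
  conv_lhs => rw [matrix_eq_sum_single (Matrix.of fun xy x'y' : Fin dA' × Fin dB' =>
    ρ ((p.1.1, xy.1), (xy.2, p.2.2)) ((q.1.1, x'y'.1), (x'y'.2, q.2.2)))]
  simp only [map_sum, Matrix.sum_apply, Matrix.of_apply]
  refine Finset.sum_congr rfl fun i _ => Finset.sum_congr rfl fun j _ => ?_
  rw [← smul_eq_mul, ← Matrix.smul_apply, ← map_smul, Matrix.smul_single, smul_eq_mul, mul_one]

lemma choi_posSemidef {dA' dB' dA dB : ℕ}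
    {N : Matrix (Fin dA' × Fin dB') (Fin dA' × Fin dB') ℂ →ₗ[ℂ]
      Matrix (Fin dA × Fin dB) (Fin dA × Fin dB) ℂ} (hN : IsQuantumChannel N) :
    (choi N).PosSemidef := by
  let e : Fin dA' × Fin dB' ≃ Fin (dA' * dB') := finProdFinEquiv
  let v : Fin (dA' * dB') × (Fin dA' × Fin dB') → ℂ := fun x => if e.symm x.1 = x.2 then 1 else 0
  convert (hN.2 _ _ (posSemidef_vecMulVec_self_star v)).submatrix
    fun x : (Fin dA' × Fin dA) × (Fin dB × Fin dB') => (e (x.1.1, x.2.2), (x.1.2, x.2.1)) using 1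
  ext p q
  simp only [choi, idTensor, Matrix.of_apply, Matrix.submatrix_apply]
  refine congrArg (fun Z => N Z _ _) ?_
  ext u w
  by_cases h₁ : (p.1.1, p.2.2) = u <;> by_cases h₂ : (q.1.1, q.2.2) = w <;>
    simp [v, Matrix.vecMulVec_apply, h₁, h₂]

lemma opNorm_nonneg {m n : Type*} [Fintype m] [Fintype n] [DecidableEq n] (X : Matrix m n ℂ) :
    0 ≤ opNorm X :=
  Real.iSup_nonneg fun _ => Real.sqrt_nonneg _

lemma sq_opNorm_smul_one_sub_posSemidef {m n : Type*} [Fintype m] [Fintype n] [DecidableEq n]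
    (X : Matrix m n ℂ) :
    (((opNorm X ^ 2 : ℝ) : ℂ) • (1 : Matrix n n ℂ) - Xᴴ * X).PosSemidef := by
  have hH := (Matrix.posSemidef_conjTranspose_mul_self X).1
  have key : ∀ i, hH.eigenvalues i ≤ opNorm X ^ 2 := fun i => by
    have h := le_ciSup (f := fun i => Real.sqrt (hH.eigenvalues i))
      (Set.finite_range _).bddAbove i
    exact (Real.sqrt_le_left (opNorm_nonneg X)).1 h
  have hD : (Matrix.diagonal fun i =>
      ((opNorm X ^ 2 : ℝ) : ℂ) - (hH.eigenvalues i : ℂ)).PosSemidef := by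
    refine PosSemidef.diagonal fun i => ?_
    have := sub_nonneg.2 (key i)
    simpa only [Pi.zero_apply, ← Complex.ofReal_sub, Complex.zero_le_real] using this
  convert hD.mul_mul_conjTranspose_same (hH.eigenvectorUnitary : Matrix n n ℂ) using 1
  have hU : (hH.eigenvectorUnitary : Matrix n n ℂ) * (hH.eigenvectorUnitary : Matrix n n ℂ)ᴴ = 1 :=
    Unitary.mul_star_self_of_mem hH.eigenvectorUnitary.2
  conv_lhs => rw [hH.spectral_theorem, Unitary.conjStarAlgAut_apply]
  rw [← Matrix.diagonal_sub, Matrix.mul_sub, Matrix.sub_mul, ← Matrix.smul_one_eq_diagonal,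
    Matrix.mul_smul, Matrix.smul_mul, Matrix.mul_one, hU]
  rfl

/-- A positive semidefinite matrix is bounded by its operator norm in the Loewner order. -/
lemma opNorm_smul_one_sub_posSemidef {n : Type*} [Fintype n] [DecidableEq n]
    {M : Matrix n n ℂ} (hM : M.PosSemidef) :
    ((opNorm M : ℂ) • (1 : Matrix n n ℂ) - M).PosSemidef := by
  have hsq := sq_opNorm_smul_one_sub_posSemidef M
  set c := opNorm M
  rcases (opNorm_nonneg M).eq_or_lt with h0 | hpos
  · have hc0 : c = 0 := h0.symm
    have htr : (Mᴴ * M).trace = 0 := by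
      refine le_antisymm ?_ (posSemidef_conjTranspose_mul_self M).trace_nonneg
      simpa [hc0] using hsq.trace_nonneg
    rw [trace_conjTranspose_mul_self_eq_zero_iff.1 htr, hc0]
    simpa using PosSemidef.zero
  · have hc0 : (c : ℂ) ≠ 0 := by exact_mod_cast hpos.ne'
    have h := ((posSemidef_conjTranspose_mul_self ((c : ℂ) • (1 : Matrix n n ℂ) - M)).add
      hsq).smul (show (0 : ℝ) ≤ (2 * c)⁻¹ by have : 0 < c := hpos; positivity)
    convert h using 1
    rw [conjTranspose_sub, conjTranspose_smul, conjTranspose_one, hM.1.eq]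
    simp only [Matrix.sub_mul, Matrix.mul_sub, Matrix.smul_mul, Matrix.mul_smul, Matrix.one_mul,
      Matrix.mul_one]
    ext i j
    simp
    field_simp
    ring

section Trace

variable {dA' dB' dA dB : ℕ} {LA LB : Type*} [Fintype LA] [Fintype LB]

lemma trace_link_le
    {X : Matrix ((LA × Fin dA') × (Fin dB' × LB)) ((LA × Fin dA') × (Fin dB' × LB)) ℂ}
    {M : Matrix ((Fin dA' × Fin dA) × (Fin dB × Fin dB'))
      ((Fin dA' × Fin dA) × (Fin dB × Fin dB')) ℂ}
    (hX : X.PosSemidef) (hM : M.PosSemidef) :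
    (link X M).trace.re ≤ X.trace.re * opNorm (ptrAB M) := by
  let XL : Matrix (Fin dA' × Fin dB') (Fin dA' × Fin dB') ℂ :=
    ∑ l : LA × LB, X.submatrix (fun i => ((l.1, i.1), (i.2, l.2)))
      (fun i => ((l.1, i.1), (i.2, l.2)))
  have hXL : XL.PosSemidef := posSemidef_sum _ fun l _ => hX.submatrix _
  have hptr : ptrAB M = ∑ u : Fin dA × Fin dB,
      M.submatrix (fun i => ((i.1, u.1), (u.2, i.2))) (fun i => ((i.1, u.1), (u.2, i.2))) := by
    ext i j
    simp [ptrAB, Matrix.sum_apply, Fintype.sum_prod_type]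
  have hT : (ptrAB M).PosSemidef := hptr ▸ posSemidef_sum _ fun u _ => hM.submatrix _
  have htrX : X.trace = XL.trace := by
    simp only [Matrix.trace, Matrix.diag_apply, XL, Matrix.sum_apply, Matrix.submatrix_apply]
    rw [← Fintype.sum_prod_type']
    exact Fintype.sum_equiv
      ⟨fun x => ((x.1.2, x.2.1), (x.1.1, x.2.2)), fun x => ((x.2.1, x.1.1), (x.1.2, x.2.2)),
        fun _ => rfl, fun _ => rfl⟩ _ _ fun _ => rfl
  have htr : (link X M).trace = ∑ i, ∑ j, XL i j * ptrAB M i j := by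
    simp only [hptr, XL, Matrix.sum_apply, Matrix.submatrix_apply, Finset.sum_mul_sum,
      Matrix.trace, Matrix.diag_apply, link, Matrix.of_apply]
    rw [Finset.sum_comm]
    refine Finset.sum_congr rfl fun i _ => ?_
    rw [Finset.sum_comm]
    refine Finset.sum_congr rfl fun j _ => ?_
    rw [← Fintype.sum_prod_type']
    exact Fintype.sum_equiv
      ⟨fun x => ((x.1.1, x.2.2), (x.1.2, x.2.1)), fun x => ((x.1.1, x.2.1), (x.2.2, x.1.2)),
        fun _ => rfl, fun _ => rfl⟩ _ _ fun _ => rfl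
  have h := (hXL.hadamard (opNorm_smul_one_sub_posSemidef hT)).dotProduct_mulVec_nonneg
    (fun _ => 1)
  have h' : 0 ≤ (opNorm (ptrAB M) : ℂ) * XL.trace - ∑ i, ∑ j, XL i j * ptrAB M i j := by
    convert h using 1
    simp [dotProduct, mulVec, Matrix.one_apply, mul_sub, Matrix.trace, Finset.mul_sum,
      Finset.sum_sub_distrib, mul_comm (XL _ _) (opNorm _ : ℂ)]
  rw [← htr, ← htrX] at h'
  have := (Complex.le_def.1 h').1
  simp at this
  linarith

end Trace

lemma exists_ptB_sub_posSemidef {X Y : Type*} [Fintype X] [Fintype Y]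
    {τ : Matrix (X × Y) (X × Y) ℂ} (hτ : τ.PosSemidef) :
    ∃ C D : Matrix (X × Y) (X × Y) ℂ, C.PosSemidef ∧ D.PosSemidef ∧
      (ptB (C - D) - τ).PosSemidef := by
  classical
  refine ⟨(opNorm τ : ℂ) • 1, 0, PosSemidef.one.smul (by simpa using opNorm_nonneg τ),
    PosSemidef.zero, ?_⟩
  convert opNorm_smul_one_sub_posSemidef hτ using 2
  ext p q
  by_cases h₁ : p.1 = q.1 <;> by_cases h₂ : p.2 = q.2 <;>
    simp [ptB, Matrix.one_apply, Prod.ext_iff, h₁, h₂, eq_comm]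

lemma le_mul_sInf {w a : ℝ} {s : Set ℝ} (ha : 0 ≤ a) (hs : s.Nonempty)
    (h : ∀ b ∈ s, w ≤ a * b) : w ≤ a * sInf s := by
  rw [← smul_eq_mul, ← Real.sInf_smul_of_nonneg ha]
  refine le_csInf hs.smul_set ?_
  rintro _ ⟨b, hb, rfl⟩
  exact h b hb

end MaxRains

open MaxRains in
/-- amortization does not enhance the bidirectional max-Rains information:
for every bipartite channel `N`, all ancillas, and every density matrix `ρ` on
`L_A ⊗ A' ⊗ B' ⊗ L_B`, `W(L_A A ; B L_B)_{N(ρ)} ≤ W(L_A A' ; B' L_B)_ρ · Γ(N)`. -/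
theorem stmt0 {dA' dB' dA dB : ℕ}
    (N : Matrix (Fin dA' × Fin dB') (Fin dA' × Fin dB') ℂ →ₗ[ℂ]
      Matrix (Fin dA × Fin dB) (Fin dA × Fin dB) ℂ)
    (hN : IsQuantumChannel N)
    (dLA dLB : ℕ)
    (ρ : Matrix ((Fin dLA × Fin dA') × (Fin dB' × Fin dLB))
      ((Fin dLA × Fin dA') × (Fin dB' × Fin dLB)) ℂ)
    (hρ : DensityMatrix ρ) :
    Wq (extendChannel N ρ) ≤ Wq ρ * GammaN N := by
  have hJ := choi_posSemidef hN
  obtain ⟨C₀, D₀, hC₀, hD₀, hρ₀⟩ := exists_ptB_sub_posSemidef hρ.1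
  obtain ⟨V₀, Y₀, hV₀, hY₀, hJ₀⟩ := exists_ptB_sub_posSemidef hJ
  have hΓ : 0 ≤ GammaN N := by
    refine Real.sInf_nonneg ?_
    rintro _ ⟨V, Y, -, -, -, rfl⟩
    exact opNorm_nonneg _
  rw [mul_comm]
  refine le_mul_sInf hΓ ⟨_, C₀, D₀, hC₀, hD₀, hρ₀, rfl⟩ ?_
  rintro _ ⟨C, D, hC, hD, hP, rfl⟩
  rw [mul_comm]
  refine le_mul_sInf (Complex.le_def.1 (hC.add hD).trace_nonneg).1
    ⟨_, V₀, Y₀, hV₀, hY₀, hJ₀, rfl⟩ ?_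
  rintro _ ⟨V, Y, hV, hY, hQ, rfl⟩
  refine le_trans (csInf_le ?_ ?_) (trace_link_le (hC.add hD) (hV.add hY))
  · refine ⟨0, ?_⟩
    rintro _ ⟨C', D', hC', hD', -, rfl⟩
    exact (Complex.le_def.1 (hC'.add hD').trace_nonneg).1
  · refine ⟨link C V + link D Y, link C Y + link D V,
      (link_posSemidef hC hV).add (link_posSemidef hD hY),
      (link_posSemidef hC hY).add (link_posSemidef hD hV), ?_, ?_⟩
    · have hsplit : link C V + link D Y - (link C Y + link D V) = link (C - D) (V - Y) := by
        rw [link_sub_left, link_sub_right, link_sub_right]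
        abel
      rw [hsplit, ← link_ptB, extendChannel_eq_link]
      convert ((link_posSemidef hP hJ).add (link_posSemidef hP hQ)).add
        (link_posSemidef hρ.1 hQ) using 1
      simp only [link_sub_left, link_sub_right]
      abel
    · rw [link_add_left, link_add_right, link_add_right]
      congr 2
      abel
end
end

section
/- Fix d ≥ 2 and q ∈ [0,1]. On ℂ^d define the shift X(k)|j⟩ = |(j+k) mod d⟩ and phase Z(l)|j⟩ = e^{2πi l j/d}|j⟩, and for x = k + d·l (0 ≤ k, l ≤ d−1) set σ^x = X(k)Z(l) (the d² Heisenberg–Weyl unitaries). Let ℂ^{d+1} have orthonormal basis |0⟩,…,|d−1⟩,|e⟩ and let U^q : ℂ^d → ℂ^{d+1} ⊗ ℂ^{d+1} be the isometry U^q|ψ⟩ = √(1−q)·|ψ⟩_B ⊗ |e⟩_E + √q·|e⟩_B ⊗ |ψ⟩_E (the isometric extension of the qudit erasure channel with erasure probability q). Define the classical–quantum state ρ on X ⊗ L_B ⊗ B ⊗ E (dimensions d², d, d+1, d+1): ρ = (1/d²) ∑_{x=0}^{d²−1} |x⟩⟨x|_X ⊗ (1_{L_B} ⊗ U^q σ^x)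 Φ_{L_B B'} (1_{L_B} ⊗ U^q σ^x)†, where Φ_{L_B B'} is the maximally entangled state on ℂ^d ⊗ ℂ^d. Then I(X;E)_ρ = 0 and I(X; L_B B)_ρ = 2(1−q)·log₂ d. -/
open Matrix Kronecker
open scoped ComplexOrder

noncomputable section

/-- The von Neumann entropy (base 2) of a matrix, via its eigenvalues. -/
def entropy {n : Type*} [Fintype n] [DecidableEq n] (ρ : Matrix n n ℂ) : ℝ :=
  if h : ρ.IsHermitian then (∑ i, Real.negMulLog (h.eigenvalues i)) / Real.log 2 else 0

/-- The maximally entangled state of Schmidt rank `d` on `ℂ^d ⊗ ℂ^d`. -/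
def maxEntSq (d : ℕ) : Matrix (Fin d × Fin d) (Fin d × Fin d) ℂ :=
  Matrix.of fun p q => if p.2 = p.1 ∧ q.2 = q.1 then ((d : ℂ))⁻¹ else 0

/-- The Heisenberg–Weyl unitary `σ^x = X(k) Z(l)` on `ℂ^d`, for `x = k + d·l`:
entries `(σ^x)_{i,j} = δ_{i, (j+k) mod d} · e^{2πi l j / d}`. -/
def HW (d : ℕ) (x : Fin (d * d)) : Matrix (Fin d) (Fin d) ℂ :=
  Matrix.of fun i j =>
    (if (i : ℕ) = ((j : ℕ) + (x : ℕ) % d) % d then 1 else 0) *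
      Complex.exp (2 * (Real.pi : ℂ) * Complex.I *
        (((((x : ℕ) / d) * (j : ℕ) : ℕ)) : ℂ) / (d : ℂ))

/-- The isometric extension `U^q : ℂ^d → ℂ^{d+1} ⊗ ℂ^{d+1}` of the qudit erasure channel:
`U^q|ψ⟩ = √(1−q)|ψ⟩_B|e⟩_E + √q|e⟩_B|ψ⟩_E`, with erasure state `|e⟩` the last basis
vector. -/
def eraseIso (d : ℕ) (q : ℝ) : Matrix (Fin (d + 1) × Fin (d + 1)) (Fin d) ℂ :=
  Matrix.of fun p j =>
    (if p.1 = Fin.castSucc j ∧ p.2 = Fin.last d then ((Real.sqrt (1 - q) : ℝ) : ℂ) else 0) +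
    (if p.1 = Fin.last d ∧ p.2 = Fin.castSucc j then ((Real.sqrt q : ℝ) : ℂ) else 0)

/-- `(1_{L_B} ⊗ U^q σ^x)`. -/
def eraseOp (d : ℕ) (q : ℝ) (x : Fin (d * d)) :
    Matrix (Fin d × (Fin (d + 1) × Fin (d + 1))) (Fin d × Fin d) ℂ :=
  (1 : Matrix (Fin d) (Fin d) ℂ) ⊗ₖ (eraseIso d q * HW d x)

/-- The pure state `(1 ⊗ U^q σ^x) Φ (1 ⊗ U^q σ^x)†` on `L_B ⊗ B ⊗ E`, re-associated to
`(L_B × B) × E`. -/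
def eraseState (d : ℕ) (q : ℝ) (x : Fin (d * d)) :
    Matrix ((Fin d × Fin (d + 1)) × Fin (d + 1)) ((Fin d × Fin (d + 1)) × Fin (d + 1)) ℂ :=
  (eraseOp d q x * maxEntSq d * (eraseOp d q x)ᴴ).submatrix
    (Equiv.prodAssoc (Fin d) (Fin (d + 1)) (Fin (d + 1)))
    (Equiv.prodAssoc (Fin d) (Fin (d + 1)) (Fin (d + 1)))

/-- The classical–quantum state `ρ = (1/d²) ∑_x |x⟩⟨x|_X ⊗ (1 ⊗ U^q σ^x)Φ(1 ⊗ U^q σ^x)†`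
on `X ⊗ L_B ⊗ B ⊗ E`. -/
def cqErase (d : ℕ) (q : ℝ) :
    Matrix (Fin (d * d) × ((Fin d × Fin (d + 1)) × Fin (d + 1)))
      (Fin (d * d) × ((Fin d × Fin (d + 1)) × Fin (d + 1))) ℂ :=
  (((d : ℂ) * d))⁻¹ • ∑ x : Fin (d * d), Matrix.single x x (1 : ℂ) ⊗ₖ eraseState d q x

/-- Reduced state on `X`. -/
def margX (d : ℕ) (q : ℝ) : Matrix (Fin (d * d)) (Fin (d * d)) ℂ :=
  Matrix.of fun x y => ∑ s : (Fin d × Fin (d + 1)) × Fin (d + 1), cqErase d q (x, s) (y, s)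

/-- Reduced state on `E`. -/
def margE (d : ℕ) (q : ℝ) : Matrix (Fin (d + 1)) (Fin (d + 1)) ℂ :=
  Matrix.of fun e f => ∑ x : Fin (d * d), ∑ m : Fin d × Fin (d + 1),
    cqErase d q (x, (m, e)) (x, (m, f))

/-- Reduced state on `X ⊗ E`. -/
def margXE (d : ℕ) (q : ℝ) :
    Matrix (Fin (d * d) × Fin (d + 1)) (Fin (d * d) × Fin (d + 1)) ℂ :=
  Matrix.of fun p q' => ∑ m : Fin d × Fin (d + 1),
    cqErase d q (p.1, (m, p.2)) (q'.1, (m, q'.2))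

/-- Reduced state on `L_B ⊗ B`. -/
def margLB (d : ℕ) (q : ℝ) :
    Matrix (Fin d × Fin (d + 1)) (Fin d × Fin (d + 1)) ℂ :=
  Matrix.of fun m m' => ∑ x : Fin (d * d), ∑ e : Fin (d + 1),
    cqErase d q (x, (m, e)) (x, (m', e))

/-- Reduced state on `X ⊗ L_B ⊗ B`. -/
def margXLB (d : ℕ) (q : ℝ) :
    Matrix (Fin (d * d) × (Fin d × Fin (d + 1))) (Fin (d * d) × (Fin d × Fin (d + 1))) ℂ :=
  Matrix.of fun p q' => ∑ e : Fin (d + 1),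
    cqErase d q (p.1, (p.2, e)) (q'.1, (q'.2, e))

/-- The trace of a power of a Hermitian matrix is the corresponding power sum of its eigenvalues. -/
theorem Matrix.IsHermitian.trace_pow_eq_sum_eigenvalues {n : Type*} [Fintype n] [DecidableEq n]
    {M : Matrix n n ℂ} (hM : M.IsHermitian) (k : ℕ) :
    (M ^ k).trace = ∑ i, (hM.eigenvalues i : ℂ) ^ k := by
  conv_lhs => rw [hM.spectral_theorem]
  rw [← map_pow, Unitary.conjStarAlgAut_apply, Matrix.trace_mul_comm, ← mul_assoc,
    Unitary.coe_star_mul_self, one_mul, Matrix.diagonal_pow, Matrix.trace_diagonal]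
  simp

/-- Positive-order power sums determine the sum of any function vanishing at `0`. -/
theorem sum_apply_eq_of_power_sums {ι κ : Type*} [Fintype ι] [Fintype κ] (v : ι → ℝ)
    (c w : κ → ℝ) (h : ∀ k, 1 ≤ k → ∑ i, v i ^ k = ∑ j, c j * w j ^ k) (f : ℝ → ℝ)
    (hf : f 0 = 0) : ∑ i, f (v i) = ∑ j, c j * f (w j) := by
  classical
  set s : Finset ℝ := insert 0 (Finset.univ.image v ∪ Finset.univ.image w) with hs
  set P := Lagrange.interpolate s id f
  have hev : ∀ x ∈ s, P.eval x = f x := fun x hx =>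
    Lagrange.eval_interpolate_at_node (v := id) f (Set.injOn_id _) hx
  have h0 : P.coeff 0 = 0 := by
    rw [Polynomial.coeff_zero_eq_eval_zero, hev 0 (by simp [hs]), hf]
  rw [Finset.sum_congr rfl fun i _ => (hev (v i) (by simp [hs])).symm,
    Finset.sum_congr rfl fun j _ => congrArg (c j * ·) (hev (w j) (by simp [hs])).symm]
  simp only [Polynomial.eval_eq_sum_range, Finset.mul_sum]
  rw [Finset.sum_comm, Finset.sum_comm (s := Finset.univ) (t := Finset.range _)]
  refine Finset.sum_congr rfl fun k _ => ?_
  rcases Nat.eq_zero_or_pos k with rfl | hk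
  · simp [h0]
  · rw [← Finset.mul_sum, h k hk, Finset.mul_sum]
    exact Finset.sum_congr rfl fun j _ => by ring

/-- The entropy of a Hermitian matrix is determined by the traces of its powers. -/
theorem entropy_eq_of_trace_pow {n κ : Type*} [Fintype n] [DecidableEq n] [Fintype κ]
    {M : Matrix n n ℂ} (hM : M.IsHermitian) (c w : κ → ℝ)
    (h : ∀ k, 1 ≤ k → (M ^ k).trace = ((∑ j, c j * w j ^ k : ℝ) : ℂ)) :
    entropy M = (∑ j, c j * Real.negMulLog (w j)) / Real.log 2 := by
  rw [entropy, dif_pos hM, sum_apply_eq_of_power_sums hM.eigenvalues c w _ _ Real.negMulLog_zero]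
  intro k hk
  have := (hM.trace_pow_eq_sum_eigenvalues k).symm.trans (h k hk)
  exact_mod_cast this

theorem entropy_diagonal {n : Type*} [Fintype n] [DecidableEq n] (f : n → ℝ) :
    entropy (Matrix.diagonal fun i => (f i : ℂ)) =
      (∑ i, Real.negMulLog (f i)) / Real.log 2 := by
  rw [entropy_eq_of_trace_pow (c := fun _ => 1) (w := f)]
  · simp
  · exact Matrix.isHermitian_diagonal_of_self_adjoint _ (by ext i; simp)
  · intro k _
    simp [Matrix.diagonal_pow, Matrix.trace_diagonal]

/-- Entropy of a combination of two orthogonal projections of traces `p` and `r`. -/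
theorem entropy_smul_add_smul {n : Type*} [Fintype n] [DecidableEq n] {P Q : Matrix n n ℂ}
    (hP : P.IsHermitian) (hQ : Q.IsHermitian) (hPP : P * P = P) (hQQ : Q * Q = Q)
    (hPQ : P * Q = 0) {p r : ℝ} (hp : P.trace = p) (hr : Q.trace = r) (α β : ℝ) :
    entropy ((α : ℂ) • P + (β : ℂ) • Q) =
      (p * Real.negMulLog α + r * Real.negMulLog β) / Real.log 2 := by
  have hM : ((α : ℂ) • P + (β : ℂ) • Q).IsHermitian := by
    simp [Matrix.IsHermitian, Matrix.conjTranspose_add, Matrix.conjTranspose_smul, hP.eq, hQ.eq]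
  have hQP : Q * P = 0 := by
    simpa [hP.eq, hQ.eq] using congrArg Matrix.conjTranspose hPQ
  have hpow : ∀ k, ((α : ℂ) • P + (β : ℂ) • Q) ^ (k + 1) =
      ((α : ℂ) ^ (k + 1)) • P + ((β : ℂ) ^ (k + 1)) • Q := by
    intro k
    induction k with
    | zero => simp
    | succ k ih =>
      rw [pow_succ, ih]
      simp only [add_mul, mul_add, Matrix.smul_mul, Matrix.mul_smul, hPP, hQQ, hPQ, hQP, smul_smul,
        smul_zero, add_zero, zero_add, mul_comm, pow_succ]
  rw [entropy_eq_of_trace_pow hM ![p, r] ![α, β]]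
  · simp [Fin.sum_univ_two]
  · intro k hk
    obtain ⟨k, rfl⟩ := Nat.exists_eq_add_of_le' hk
    rw [hpow, Matrix.trace_add, Matrix.trace_smul, Matrix.trace_smul, hp, hr]
    simp [Fin.sum_univ_two, mul_comm]

/-- In coordinates, `σ^(k + d·l)` has entries `δ_{i, j+k} ω^{l j}` with `ω = e^{2πi/d}`. -/
theorem HW_apply {d : ℕ} [NeZero d] (l k i j : Fin d) :
    HW d (finProdFinEquiv (l, k)) i j =
      if i = j + k then
        (Complex.exp (2 * Real.pi * Complex.I / d) ^ (j : ℕ)) ^ (l : ℕ) else 0 := by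
  have hd : 0 < d := Nat.pos_of_neZero d
  have h1 : ((k : ℕ) + d * l) % d = k := by simp [Nat.mod_eq_of_lt k.2]
  have h2 : ((k : ℕ) + d * l) / d = l := by
    rw [Nat.add_mul_div_left _ _ hd, Nat.div_eq_of_lt k.2, zero_add]
  simp only [HW, Matrix.of_apply, finProdFinEquiv_apply_val, h1, h2, Fin.ext_iff, Fin.val_add,
    ite_mul, one_mul, zero_mul]
  refine if_congr Iff.rfl ?_ rfl
  rw [← Complex.exp_nat_mul, ← Complex.exp_nat_mul]
  congr 1
  push_cast
  ring

theorem star_exp_two_pi_div (d : ℕ) :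
    star (Complex.exp (2 * Real.pi * Complex.I / d)) =
      (Complex.exp (2 * Real.pi * Complex.I / d))⁻¹ := by
  rw [← Complex.exp_neg, Complex.star_def, ← Complex.exp_conj]
  simp [neg_div, Complex.conj_ofNat]

theorem HW_row_orthonormal {d : ℕ} [NeZero d] (x : Fin (d * d)) (i j : Fin d) :
    ∑ a, HW d x i a * star (HW d x j a) = if i = j then 1 else 0 := by
  obtain ⟨⟨l, k⟩, rfl⟩ := finProdFinEquiv.surjective x
  have hω := Complex.exp_ne_zero (2 * Real.pi * Complex.I / d)
  rw [← Equiv.sum_comp (Equiv.subRight k)]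
  simp only [HW_apply, Equiv.subRight_apply, sub_add_cancel]
  rw [Finset.sum_eq_single i (by intro b _ hb; simp [hb.symm]) (by simp)]
  rcases eq_or_ne i j with rfl | h
  · simp only [if_true, star_pow, star_exp_two_pi_div]
    rw [← mul_pow, ← mul_pow, mul_inv_cancel₀ hω, one_pow, one_pow]
  · simp [h, h.symm]

theorem sum_HW_mul_star {d : ℕ} [NeZero d] (i a j b : Fin d) :
    ∑ x, HW d x i a * star (HW d x j b) = if i = j ∧ a = b then (d : ℂ) else 0 := by
  have hω := Complex.exp_ne_zero (2 * Real.pi * Complex.I / d)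
  have hprim := Complex.isPrimitiveRoot_exp d (NeZero.ne d)
  rw [← finProdFinEquiv.sum_comp, Fintype.sum_prod_type_right]
  simp only [HW_apply]
  set ω := Complex.exp (2 * Real.pi * Complex.I / d) with hωdef
  have hstar : star ω = ω⁻¹ := star_exp_two_pi_div d
  have hsum : ∑ l : Fin d, (ω ^ (a : ℕ)) ^ (l : ℕ) * star ((ω ^ (b : ℕ)) ^ (l : ℕ)) =
      if a = b then (d : ℂ) else 0 := by
    simp only [star_pow, hstar, ← mul_pow]
    rw [Fin.sum_univ_eq_sum_range (fun l => (ω ^ (a : ℕ) * ω⁻¹ ^ (b : ℕ)) ^ l)]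
    split_ifs with hab
    · subst hab
      simp [mul_inv_cancel₀ (pow_ne_zero (a : ℕ) hω)]
    · have hne : ω ^ (a : ℕ) * ω⁻¹ ^ (b : ℕ) ≠ 1 := by
        intro h
        rw [inv_pow, mul_inv_eq_one₀ (pow_ne_zero _ hω)] at h
        exact hab (Fin.ext (hprim.pow_inj a.2 b.2 h))
      have hone : (ω ^ (a : ℕ) * ω⁻¹ ^ (b : ℕ)) ^ d = 1 := by
        rw [mul_pow, ← pow_mul, ← pow_mul, mul_comm _ d, mul_comm _ d, pow_mul, pow_mul, inv_pow,
          hprim.pow_eq_one]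
        simp
      rw [geom_sum_eq hne, hone, sub_self, zero_div]
  rw [Finset.sum_eq_single (i - a)]
  · simp only [add_sub_cancel, if_true]
    rcases eq_or_ne a b with rfl | hab
    · simp only [add_sub_cancel]
      rcases eq_or_ne i j with rfl | hij
      · simpa using hsum
      · simp [hij, hij.symm]
    · by_cases h : j = b + (i - a)
      · simp only [if_pos h, hsum, hab]
        simp
      · simp [h, hab]
  · intro k _ hk
    have : i ≠ a + k := fun h => hk (by rw [h, add_sub_cancel_left])
    simp [this]
  · simp

/-- `σ^x` followed by the inclusion `ℂ^d ⊆ ℂ^{d+1}`. -/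
def paddedHW (d : ℕ) (x : Fin (d * d)) (b : Fin (d + 1)) (a : Fin d) : ℂ :=
  Fin.lastCases (motive := fun _ => ℂ) 0 (fun i => HW d x i a) b

@[simp] theorem paddedHW_last {d : ℕ} (x : Fin (d * d)) (a : Fin d) :
    paddedHW d x (Fin.last d) a = 0 := by simp [paddedHW]

@[simp] theorem paddedHW_castSucc {d : ℕ} (x : Fin (d * d)) (i a : Fin d) :
    paddedHW d x i.castSucc a = HW d x i a := by simp [paddedHW]

theorem sum_ite_castSucc_mul_HW {d : ℕ} (x : Fin (d * d)) (b : Fin (d + 1)) (a : Fin d) (c : ℂ) :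
    ∑ j : Fin d, (if b = j.castSucc then c else 0) * HW d x j a = c * paddedHW d x b a := by
  induction b using Fin.lastCases with
  | last => simp [(Fin.castSucc_ne_last _).symm]
  | cast i => simp

theorem eraseIso_mul_HW_apply (d : ℕ) (q : ℝ) (x : Fin (d * d)) (b e : Fin (d + 1)) (a : Fin d) :
    (eraseIso d q * HW d x) (b, e) a =
      (if e = Fin.last d then (Real.sqrt (1 - q) : ℂ) * paddedHW d x b a else 0) +
      (if b = Fin.last d then (Real.sqrt q : ℂ) * paddedHW d x e a else 0) := by
  rw [Matrix.mul_apply]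
  simp only [eraseIso, Matrix.of_apply, add_mul, Finset.sum_add_distrib]
  rw [← sum_ite_castSucc_mul_HW, ← sum_ite_castSucc_mul_HW]
  by_cases h : e = Fin.last d <;> by_cases h' : b = Fin.last d <;> simp [h, h']

theorem eraseState_apply (d : ℕ) (q : ℝ) (x : Fin (d * d)) (a a' : Fin d)
    (b b' e e' : Fin (d + 1)) :
    eraseState d q x ((a, b), e) ((a', b'), e') =
      (d : ℂ)⁻¹ * (eraseIso d q * HW d x) (b, e) a *
        star ((eraseIso d q * HW d x) (b', e') a') := by
  rw [eraseState, eraseOp]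
  generalize eraseIso d q * HW d x = A
  simp only [Matrix.submatrix_apply, Equiv.prodAssoc_apply, Matrix.mul_apply, maxEntSq,
    Matrix.conjTranspose_apply, Matrix.kroneckerMap_apply, Matrix.of_apply,
    Fintype.sum_prod_type, Matrix.one_apply]
  simp [ite_and, apply_ite, mul_comm]

theorem cqErase_apply (d : ℕ) (q : ℝ) (x y : Fin (d * d))
    (s t : (Fin d × Fin (d + 1)) × Fin (d + 1)) :
    cqErase d q (x, s) (y, t) =
      if x = y then ((d : ℂ) * d)⁻¹ * eraseState d q x s t else 0 := by
  simp only [cqErase, Matrix.smul_apply, Matrix.sum_apply, Matrix.kroneckerMap_apply,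
    Matrix.single_apply, smul_eq_mul]
  split_ifs with h
  · subst h
    rw [Finset.sum_eq_single x] <;> simp +contextual
  · rw [Finset.sum_eq_zero, mul_zero]
    rintro z -
    rw [if_neg (by rintro ⟨rfl, rfl⟩; exact h rfl), zero_mul]

theorem HW_column_orthonormal {d : ℕ} [NeZero d] (x : Fin (d * d)) (a b : Fin d) :
    ∑ i, HW d x i a * star (HW d x i b) = if a = b then 1 else 0 := by
  have h : HW d x * (HW d x)ᴴ = 1 := by
    ext i j
    simpa [Matrix.mul_apply, Matrix.one_apply] using HW_row_orthonormal x i j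
  have h' := congrArg (fun M => M b a) (mul_eq_one_comm.mp h)
  simp only [Matrix.mul_apply, Matrix.conjTranspose_apply, Matrix.one_apply] at h'
  rw [if_congr eq_comm rfl rfl, ← h']
  exact Finset.sum_congr rfl fun i _ => mul_comm _ _

theorem paddedHW_row_orthonormal {d : ℕ} [NeZero d] (x : Fin (d * d)) (b b' : Fin (d + 1)) :
    ∑ a, paddedHW d x b a * star (paddedHW d x b' a) =
      if b = b' ∧ b ≠ Fin.last d then 1 else 0 := by
  induction b using Fin.lastCases with
  | last => simp
  | cast i =>
    induction b' using Fin.lastCases with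
    | last => simp
    | cast j => simpa using HW_row_orthonormal x i j

theorem paddedHW_column_orthonormal {d : ℕ} [NeZero d] (x : Fin (d * d)) (a a' : Fin d) :
    ∑ b, paddedHW d x b a * star (paddedHW d x b a') = if a = a' then 1 else 0 := by
  simpa [Fin.sum_univ_castSucc] using HW_column_orthonormal x a a'

theorem sum_paddedHW_mul_star {d : ℕ} [NeZero d] (b b' : Fin (d + 1)) (a a' : Fin d) :
    ∑ x, paddedHW d x b a * star (paddedHW d x b' a') =
      if (a, b) = (a', b') ∧ b ≠ Fin.last d then (d : ℂ) else 0 := by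
  induction b using Fin.lastCases with
  | last => simp
  | cast i =>
    induction b' using Fin.lastCases with
    | last => simp
    | cast j => simpa [and_comm] using sum_HW_mul_star i a j a'

theorem ofReal_sqrt_mul_sqrt {r : ℝ} (hr : 0 ≤ r) : (Real.sqrt r : ℂ) * Real.sqrt r = r := by
  rw [← Complex.ofReal_mul, Real.mul_self_sqrt hr]

/-- Partial trace of a conditional state over `L_B ⊗ B`. -/
theorem sum_eraseState_LB {d : ℕ} [NeZero d] {q : ℝ} (hq : q ∈ Set.Icc (0 : ℝ) 1)
    (x : Fin (d * d)) (e f : Fin (d + 1)) :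
    ∑ m, eraseState d q x (m, e) (m, f) =
      if e = f then (((if e = Fin.last d then 1 - q else q / d) : ℝ) : ℂ) else 0 := by
  have hd : (d : ℂ) ≠ 0 := Nat.cast_ne_zero.mpr (NeZero.ne d)
  have h1 := ofReal_sqrt_mul_sqrt (sub_nonneg.mpr hq.2)
  have h2 := ofReal_sqrt_mul_sqrt hq.1
  have hcol : ∑ a, ∑ i, HW d x i a * star (HW d x i a) = d := by
    simp only [HW_column_orthonormal]
    simp
  have hterm : ∀ a, ∑ b, eraseState d q x ((a, b), e) ((a, b), f) =
      (if e = Fin.last d ∧ f = Fin.last d then (d : ℂ)⁻¹ * (1 - q : ℝ) else 0) *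
        ∑ i, HW d x i a * star (HW d x i a) +
      (d : ℂ)⁻¹ * q * (paddedHW d x e a * star (paddedHW d x f a)) := by
    intro a
    rw [← h1, ← h2, Fin.sum_univ_castSucc, Finset.mul_sum]
    simp only [eraseState_apply, eraseIso_mul_HW_apply]
    congr 1
    · refine Finset.sum_congr rfl fun i _ => ?_
      by_cases he : e = Fin.last d <;> by_cases hf : f = Fin.last d <;>
        simp [he, hf, Fin.castSucc_ne_last] <;> ring
    · simp
      ring
  rw [Fintype.sum_prod_type, Finset.sum_congr rfl fun a _ => hterm a, Finset.sum_add_distrib,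
    ← Finset.mul_sum, ← Finset.mul_sum, hcol, paddedHW_row_orthonormal]
  by_cases hef : e = f
  · subst hef
    by_cases he : e = Fin.last d
    · simp [he]
      field_simp
    · simp [he]
      field_simp
  · have : ¬(e = Fin.last d ∧ f = Fin.last d) := fun h => hef (h.1.trans h.2.symm)
    simp [hef, this]

/-- Partial trace of a conditional state over `E`. -/
theorem sum_eraseState_E {d : ℕ} [NeZero d] {q : ℝ} (hq : q ∈ Set.Icc (0 : ℝ) 1)
    (x : Fin (d * d)) (m m' : Fin d × Fin (d + 1)) :
    ∑ e, eraseState d q x (m, e) (m', e) =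
      ((1 - q : ℝ) : ℂ) / d * (paddedHW d x m.2 m.1 * star (paddedHW d x m'.2 m'.1)) +
        if m = m' ∧ m.2 = Fin.last d then (q : ℂ) / d else 0 := by
  obtain ⟨a, b⟩ := m
  obtain ⟨a', b'⟩ := m'
  have h1 := ofReal_sqrt_mul_sqrt (sub_nonneg.mpr hq.2)
  have h2 := ofReal_sqrt_mul_sqrt hq.1
  have hterm : ∀ i : Fin d, eraseState d q x ((a, b), i.castSucc) ((a', b'), i.castSucc) =
      (if b = Fin.last d ∧ b' = Fin.last d then (d : ℂ)⁻¹ * q else 0) *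
        (HW d x i a * star (HW d x i a')) := by
    intro i
    rw [← h2]
    simp only [eraseState_apply, eraseIso_mul_HW_apply]
    by_cases hb : b = Fin.last d <;> by_cases hb' : b' = Fin.last d <;>
      simp [hb, hb', Fin.castSucc_ne_last] <;> ring
  rw [Fin.sum_univ_castSucc, Finset.sum_congr rfl fun i _ => hterm i, ← Finset.mul_sum,
    HW_column_orthonormal, add_comm]
  congr 1
  · rw [← h1]
    simp only [eraseState_apply, eraseIso_mul_HW_apply]
    simp
    ring
  · by_cases hb : b = Fin.last d <;> by_cases hb' : b' = Fin.last d <;>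
      by_cases ha : a = a' <;> simp [ha, hb, hb', Prod.ext_iff, eq_comm, div_eq_inv_mul]

theorem margX_eq {d : ℕ} [NeZero d] {q : ℝ} (hq : q ∈ Set.Icc (0 : ℝ) 1) :
    margX d q = Matrix.diagonal fun _ => ((1 / (d : ℝ) ^ 2 : ℝ) : ℂ) := by
  have hd : (d : ℂ) ≠ 0 := Nat.cast_ne_zero.mpr (NeZero.ne d)
  ext x y
  simp only [margX, Matrix.of_apply, cqErase_apply, Matrix.diagonal_apply]
  split_ifs with h
  · rw [← Finset.mul_sum, Fintype.sum_prod_type_right]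
    simp only [sum_eraseState_LB hq, if_true, Fin.sum_univ_castSucc, Fin.castSucc_ne_last, if_false]
    simp
    field_simp
    ring
  · simp

theorem margXE_eq {d : ℕ} [NeZero d] {q : ℝ} (hq : q ∈ Set.Icc (0 : ℝ) 1) :
    margXE d q = Matrix.diagonal fun p =>
      (((if p.2 = Fin.last d then (1 - q) / d ^ 2 else q / d ^ 3 : ℝ)) : ℂ) := by
  have hd : (d : ℂ) ≠ 0 := Nat.cast_ne_zero.mpr (NeZero.ne d)
  ext ⟨x, e⟩ ⟨y, f⟩
  simp only [margXE, Matrix.of_apply, cqErase_apply, Matrix.diagonal_apply]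
  by_cases h : x = y
  · subst h
    simp only [if_true, ← Finset.mul_sum, sum_eraseState_LB hq]
    by_cases hef : e = f
    · subst hef
      split_ifs <;> simp_all <;> field_simp
    · simp [hef]
  · simp [h]

theorem margE_eq {d : ℕ} [NeZero d] {q : ℝ} (hq : q ∈ Set.Icc (0 : ℝ) 1) :
    margE d q = Matrix.diagonal fun e =>
      (((if e = Fin.last d then 1 - q else q / d : ℝ)) : ℂ) := by
  have hd : (d : ℂ) ≠ 0 := Nat.cast_ne_zero.mpr (NeZero.ne d)
  ext e f
  simp only [margE, Matrix.of_apply, cqErase_apply, Matrix.diagonal_apply, if_true,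
    ← Finset.mul_sum, sum_eraseState_LB hq]
  by_cases hef : e = f
  · subst hef
    simp
    field_simp
  · simp [hef]

theorem margLB_eq {d : ℕ} [NeZero d] {q : ℝ} (hq : q ∈ Set.Icc (0 : ℝ) 1) :
    margLB d q = Matrix.diagonal fun m =>
      (((if m.2 = Fin.last d then q / d else (1 - q) / d ^ 2 : ℝ)) : ℂ) := by
  have hd : (d : ℂ) ≠ 0 := Nat.cast_ne_zero.mpr (NeZero.ne d)
  ext m m'
  simp only [margLB, Matrix.of_apply, cqErase_apply, Matrix.diagonal_apply, if_true,
    ← Finset.mul_sum, sum_eraseState_E hq, Finset.sum_add_distrib, sum_paddedHW_mul_star]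
  by_cases h : m = m'
  · subst h
    by_cases hm : m.2 = Fin.last d <;> simp [hm] <;> field_simp
  · simp [h]

/-- The projection onto the span of the vectors `|x⟩ ⊗ vec(σ^x)`. -/
def signalProj (d : ℕ) :
    Matrix (Fin (d * d) × (Fin d × Fin (d + 1))) (Fin (d * d) × (Fin d × Fin (d + 1))) ℂ :=
  Matrix.of fun p p' => if p.1 = p'.1 then
    (d : ℂ)⁻¹ * (paddedHW d p.1 p.2.2 p.2.1 * star (paddedHW d p'.1 p'.2.2 p'.2.1)) else 0

/-- The projection onto the span of the vectors `|x⟩ ⊗ |a⟩ ⊗ |e⟩`. -/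
def erasureProj (d : ℕ) :
    Matrix (Fin (d * d) × (Fin d × Fin (d + 1))) (Fin (d * d) × (Fin d × Fin (d + 1))) ℂ :=
  Matrix.diagonal fun p => if p.2.2 = Fin.last d then 1 else 0

theorem margXLB_eq {d : ℕ} [NeZero d] {q : ℝ} (hq : q ∈ Set.Icc (0 : ℝ) 1) :
    margXLB d q = (((1 - q) / d ^ 2 : ℝ) : ℂ) • signalProj d +
      ((q / d ^ 3 : ℝ) : ℂ) • erasureProj d := by
  have hd : (d : ℂ) ≠ 0 := Nat.cast_ne_zero.mpr (NeZero.ne d)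
  ext ⟨x, m⟩ ⟨y, m'⟩
  simp only [margXLB, Matrix.of_apply, cqErase_apply, Matrix.add_apply, Matrix.smul_apply,
    signalProj, erasureProj, Matrix.diagonal_apply, Prod.mk.injEq]
  by_cases h : x = y
  · subst h
    simp only [if_true, true_and, ← Finset.mul_sum, sum_eraseState_E hq]
    by_cases hm : m = m'
    · subst hm
      by_cases hl : m.2 = Fin.last d <;> simp [hl] <;> field_simp
    · simp [hm]
      field_simp
  · simp [h]

theorem sum_normSq_paddedHW {d : ℕ} [NeZero d] (x : Fin (d * d)) :
    ∑ m : Fin d × Fin (d + 1), paddedHW d x m.2 m.1 * star (paddedHW d x m.2 m.1) = d := by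
  rw [Fintype.sum_prod_type]
  simp only [paddedHW_column_orthonormal]
  simp

theorem entropy_margXLB {d : ℕ} [NeZero d] {q : ℝ} (hq : q ∈ Set.Icc (0 : ℝ) 1) :
    entropy (margXLB d q) = ((d : ℝ) ^ 2 * Real.negMulLog ((1 - q) / d ^ 2) +
      (d : ℝ) ^ 3 * Real.negMulLog (q / d ^ 3)) / Real.log 2 := by
  have hd : (d : ℂ) ≠ 0 := Nat.cast_ne_zero.mpr (NeZero.ne d)
  rw [margXLB_eq hq]
  apply entropy_smul_add_smul
  · ext p p'
    by_cases h : p.1 = p'.1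
    · simp [signalProj, h, mul_comm]
    · simp [signalProj, h, Ne.symm h]
  · exact Matrix.isHermitian_diagonal_of_self_adjoint _ (by ext i; simp [apply_ite])
  · ext p p'
    rw [Matrix.mul_apply, Fintype.sum_prod_type, Finset.sum_eq_single p.1]
    · have hterm : ∀ m, signalProj d p (p.1, m) * signalProj d (p.1, m) p' =
          (d : ℂ)⁻¹ * signalProj d p p' *
            (paddedHW d p.1 m.2 m.1 * star (paddedHW d p.1 m.2 m.1)) := by
        intro m
        simp only [signalProj, Matrix.of_apply, if_true]
        split_ifs <;> ring
      rw [Finset.sum_congr rfl fun m _ => hterm m, ← Finset.mul_sum, sum_normSq_paddedHW]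
      field_simp
    · intro z _ hz
      simp [signalProj, hz.symm]
    · simp
  · rw [erasureProj, Matrix.diagonal_mul_diagonal]
    simp
  · ext p p'
    by_cases h : p'.2.2 = Fin.last d <;>
    simp [erasureProj, Matrix.mul_diagonal, signalProj, h]
  · simp only [Matrix.trace, Matrix.diag, signalProj, Matrix.of_apply, if_true]
    rw [Fintype.sum_prod_type]
    simp only [← Finset.mul_sum, sum_normSq_paddedHW]
    simp
    field_simp
  · rw [erasureProj, Matrix.trace_diagonal]
    simp only [Fintype.sum_prod_type]
    simp
    ring

theorem pow_mul_negMulLog_div {d : ℕ} [NeZero d] (k : ℕ) (c : ℝ) :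
    (d : ℝ) ^ k * Real.negMulLog (c / d ^ k) = Real.negMulLog c + k * c * Real.log d := by
  have hd : (d : ℝ) ^ k ≠ 0 := pow_ne_zero _ (Nat.cast_ne_zero.mpr (NeZero.ne d))
  rw [div_eq_mul_inv, Real.negMulLog_mul, Real.negMulLog.eq_def (_⁻¹), Real.log_inv, Real.log_pow]
  field_simp

/-- for the qudit erasure wiretap memory cell,
`I(X;E)_ρ = 0` and `I(X;L_B B)_ρ = 2(1−q) log₂ d`. -/
theorem stmt7 (d : ℕ) (hd : 2 ≤ d) (q : ℝ) (hq : q ∈ Set.Icc (0:ℝ) 1) :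
    (entropy (margX d q) + entropy (margE d q) - entropy (margXE d q) = 0) ∧
    (entropy (margX d q) + entropy (margLB d q) - entropy (margXLB d q)
      = 2 * (1 - q) * Real.logb 2 d) := by
  have : NeZero d := ⟨by omega⟩
  have hX : entropy (margX d q) = 2 * Real.log d / Real.log 2 := by
    have h := pow_mul_negMulLog_div (d := d) 2 1
    rw [margX_eq hq, entropy_diagonal]
    simp at h ⊢
    rw [← h]
    ring
  have hE : entropy (margE d q) =
      (Real.negMulLog (1 - q) + (Real.negMulLog q + q * Real.log d)) / Real.log 2 := by
    have h := pow_mul_negMulLog_div (d := d) 1 q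
    rw [margE_eq hq, entropy_diagonal, Fin.sum_univ_castSucc]
    simp [Fin.castSucc_ne_last] at h ⊢
    rw [← h]
    ring
  have hXE : entropy (margXE d q) =
      (Real.negMulLog (1 - q) + 2 * (1 - q) * Real.log d +
        (Real.negMulLog q + 3 * q * Real.log d)) / Real.log 2 := by
    have h2 := pow_mul_negMulLog_div (d := d) 2 (1 - q)
    have h3 := pow_mul_negMulLog_div (d := d) 3 q
    push_cast at h2 h3
    rw [margXE_eq hq, entropy_diagonal, Fintype.sum_prod_type, ← h2, ← h3]
    simp [Fin.sum_univ_castSucc, Fin.castSucc_ne_last]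
    ring
  have hLB : entropy (margLB d q) =
      (Real.negMulLog (1 - q) + 2 * (1 - q) * Real.log d +
        (Real.negMulLog q + q * Real.log d)) / Real.log 2 := by
    have h1 := pow_mul_negMulLog_div (d := d) 1 q
    have h2 := pow_mul_negMulLog_div (d := d) 2 (1 - q)
    simp only [pow_one, Nat.cast_one, one_mul, Nat.cast_ofNat] at h1 h2
    rw [margLB_eq hq, entropy_diagonal, Fintype.sum_prod_type, ← h2, ← h1]
    simp [Fin.sum_univ_castSucc, Fin.castSucc_ne_last]
    ring
  have hXLB := entropy_margXLB (d := d) hq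
  rw [pow_mul_negMulLog_div, pow_mul_negMulLog_div] at hXLB
  push_cast at hXLB
  rw [hX, hE, hXE, hLB, hXLB, Real.logb]
  constructor <;> ring
end
end
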